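/- Let N, n be positive natural numbers, M : Matrix (Fin n) (Fin n) ℝ, and e : Fin N × Fin n → ℝ. Define ε : Fin n → ℝ by ε k = (1/(N:ℝ)) * ∑ i, e (i,k), let ē : Fin N × Fin n → ℝ be ē (i,k) = ε k, and let ẽ = e - ē. Then e ⬝ᵥ (((1 : Matrix (Fin N) (Fin N) ℝ) ⊗ₖ M) *ᵥ e) = ē ⬝ᵥ (((1 : Matrix (Fin N) (Fin N) ℝ) ⊗ₖ M) *ᵥ ē) + ẽ ⬝ᵥ (((1 : Matrix (Fin N) (Fin N) ℝ) ⊗ₖ M) *ᵥ ẽ). -/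

import Mathlib

open Matrix Kronecker BigOperators

theorem kron_form {N n : ℕ} (M : Matrix (Fin n) (Fin n) ℝ) (x y : Fin N × Fin n → ℝ) :
    x ⬝ᵥ (((1 : Matrix (Fin N) (Fin N) ℝ) ⊗ₖ M) *ᵥ y) =
      ∑ k, ∑ l, M k l * ∑ i, x (i, k) * y (i, l) := by
  have h : ∀ i k, (((1 : Matrix (Fin N) (Fin N) ℝ) ⊗ₖ M) *ᵥ y) (i, k) =
      ∑ l, M k l * y (i, l) := by
    intro i k
    simp only [Matrix.mulVec, dotProduct, Fintype.sum_prod_type, Matrix.kroneckerMap_apply]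
    rw [Finset.sum_eq_single i]
    · simp
    · intro j _ hj
      simp [Matrix.one_apply_ne hj.symm]
    · simp
  simp only [dotProduct, Fintype.sum_prod_type, h, Finset.mul_sum]
  rw [Finset.sum_comm]
  refine Finset.sum_congr rfl fun k _ => ?_
  rw [Finset.sum_comm]
  refine Finset.sum_congr rfl fun l _ => Finset.sum_congr rfl fun i _ => ?_
  ring

theorem stmt12 {N n : ℕ} (hN : 0 < N) (hn : 0 < n)
    (M : Matrix (Fin n) (Fin n) ℝ) (e : Fin N × Fin n → ℝ)
    (ε : Fin n → ℝ) (hε : ∀ k, ε k = (1 / (N : ℝ)) * ∑ i, e (i, k))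
    (ebar : Fin N × Fin n → ℝ) (hebar : ∀ i k, ebar (i, k) = ε k)
    (etil : Fin N × Fin n → ℝ) (hetil : etil = e - ebar) :
    e ⬝ᵥ (((1 : Matrix (Fin N) (Fin N) ℝ) ⊗ₖ M) *ᵥ e) =
      ebar ⬝ᵥ (((1 : Matrix (Fin N) (Fin N) ℝ) ⊗ₖ M) *ᵥ ebar) +
        etil ⬝ᵥ (((1 : Matrix (Fin N) (Fin N) ℝ) ⊗ₖ M) *ᵥ etil) := by
  have hs : ∀ k, ∑ i, etil (i, k) = 0 := by
    intro k
    have hN' : (N : ℝ) ≠ 0 := by exact_mod_cast hN.ne'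
    simp only [hetil, Pi.sub_apply, hebar, Finset.sum_sub_distrib, Finset.sum_const,
      Finset.card_univ, Fintype.card_fin, nsmul_eq_mul, hε]
    field_simp
    ring
  have he : e = ebar + etil := by rw [hetil]; abel
  have h1 : ebar ⬝ᵥ (((1 : Matrix (Fin N) (Fin N) ℝ) ⊗ₖ M) *ᵥ etil) = 0 := by
    rw [kron_form]
    simp [hebar, ← Finset.mul_sum, hs]
  have h2 : etil ⬝ᵥ (((1 : Matrix (Fin N) (Fin N) ℝ) ⊗ₖ M) *ᵥ ebar) = 0 := by
    rw [kron_form]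
    simp [hebar, ← Finset.sum_mul, hs]
  rw [he, Matrix.mulVec_add, add_dotProduct, dotProduct_add, dotProduct_add, h1, h2]
  ring
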